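/- arXiv:2208.07892 — 3 statements merged into one kernel-verified Lean document; each statement's English description precedes it below -/
import Mathlib

section
/- Let μ ∈ ℝ, ε > 0, and let (Ω,H) : [τ₀,∞) → ℝ² be a differentiable solution of the Friedmann perfect-fluid system such that 1 + (μ/2)Ω(τ) ≥ ε for all τ ≥ τ₀. Then |H(τ)| ≤ |H(τ₀)| e^{−ε(τ−τ₀)} for all τ ≥ τ₀; in particular H(τ) → 0 as τ → ∞, so all such solutions are exponentially attracted to the center manifold {H = 0}. -/
open Filter

/-- If the derivative of `f` on `[t₀, ∞)` is `-a t * f t` with `ε ≤ a t`, then `f` decays at least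
like `exp (-ε * (t - t₀))`. -/
theorem abs_le_mul_exp_of_hasDerivAt_neg_mul {f a : ℝ → ℝ} {ε t₀ : ℝ}
    (hf : ∀ t ∈ Set.Ici t₀, HasDerivAt f (-a t * f t) t) (ha : ∀ t ∈ Set.Ici t₀, ε ≤ a t)
    {t : ℝ} (ht : t ∈ Set.Ici t₀) : |f t| ≤ |f t₀| * Real.exp (-ε * (t - t₀)) := by
  have hderiv : ∀ s ∈ Set.Ici t₀, HasDerivAt (fun s ↦ (f s * Real.exp (ε * (s - t₀))) ^ 2)
      (2 * (ε - a s) * (f s * Real.exp (ε * (s - t₀))) ^ 2) s := by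
    intro s hs
    have hexp := (((hasDerivAt_id' s).sub_const t₀).const_mul ε).exp
    refine (((hf s hs).fun_mul hexp).fun_pow 2).congr_deriv ?_
    push_cast
    ring
  have hanti : AntitoneOn (fun s ↦ (f s * Real.exp (ε * (s - t₀))) ^ 2) (Set.Ici t₀) := by
    refine antitoneOn_of_hasDerivWithinAt_nonpos (convex_Ici t₀)
      (fun s hs ↦ (hderiv s hs).continuousAt.continuousWithinAt)
      (fun s hs ↦ (hderiv s (interior_subset hs)).hasDerivWithinAt) fun s hs ↦ ?_
    have := ha s (interior_subset hs)
    exact mul_nonpos_of_nonpos_of_nonneg (by linarith) (sq_nonneg _)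
  have h := sq_le_sq.mp (hanti Set.self_mem_Ici ht ht)
  simp only [sub_self, mul_zero, Real.exp_zero, mul_one, abs_mul, Real.abs_exp] at h
  rwa [neg_mul, Real.exp_neg, ← div_eq_mul_inv, le_div_iff₀ (Real.exp_pos _)]

/-- If along a solution of the Friedmann system one has `1 + (μ/2)Ω(τ) ≥ ε > 0` for all
`τ ≥ τ₀`, then `|H(τ)| ≤ |H(τ₀)| e^{−ε(τ−τ₀)}`, so `H(τ) → 0` as `τ → ∞`: solutions are
exponentially attracted to the center manifold `{H = 0}`. -/
theorem friedmann_H_exponential_decay (μ ε τ₀ : ℝ) (hε : 0 < ε) (Ω H : ℝ → ℝ)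
    (hΩ : ∀ τ ∈ Set.Ici τ₀, HasDerivAt Ω (μ * Ω τ ^ 2 - μ * Ω τ) τ)
    (hH : ∀ τ ∈ Set.Ici τ₀, HasDerivAt H (-H τ - μ / 2 * Ω τ * H τ) τ)
    (hbound : ∀ τ ∈ Set.Ici τ₀, ε ≤ 1 + μ / 2 * Ω τ) :
    (∀ τ ∈ Set.Ici τ₀, |H τ| ≤ |H τ₀| * Real.exp (-ε * (τ - τ₀))) ∧
    Tendsto H atTop (nhds 0) := by
  have hdecay : ∀ τ ∈ Set.Ici τ₀, |H τ| ≤ |H τ₀| * Real.exp (-ε * (τ - τ₀)) := fun τ hτ ↦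
    abs_le_mul_exp_of_hasDerivAt_neg_mul (a := fun τ ↦ 1 + μ / 2 * Ω τ)
      (fun s hs ↦ (hH s hs).congr_deriv (by ring)) hbound hτ
  refine ⟨hdecay, squeeze_zero_norm' ((eventually_ge_atTop τ₀).mono hdecay) ?_⟩
  have hlin : Tendsto (fun τ ↦ -ε * (τ - τ₀)) atTop atBot :=
    (tendsto_atTop_add_const_right atTop (-τ₀) tendsto_id).const_mul_atTop_of_neg (neg_lt_zero.mpr hε)
  simpa using (Real.tendsto_exp_atBot.comp hlin).const_mul |H τ₀|
end

section
/- Let φ_τ(x) = x e^τ / (x e^τ − x + 1) and ψ_τ(x) = x / (x − x e^τ + e^τ) be the flows of x' = x − x² and x' = x² − x respectively. For every x ∈ (0,1), the function τ ↦ φ_τ(x) − ψ_τ(x) is strictly increasing on ℝ (its τ-derivative is strictly positive), and lim_{τ→∞} |φ_τ(x) − ψ_τ(x)| = 1 ≠ 0. Hence the synchronization condition lim_{τ→∞} |φ_τ(x) − ψ_τ(x)| = 0 fails for every state x ∈ (0,1), i.e. a Friedmann domain governed by the reduced dynamics dΩ/dτ = μΩ(Ω−1) desynchronizes during its future evolution.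 -/
open Filter

lemma hasDerivAt_logistic {x : ℝ} (τ : ℝ) (h : x * Real.exp τ - x + 1 ≠ 0) :
    HasDerivAt (fun τ => x * Real.exp τ / (x * Real.exp τ - x + 1))
      (x * (1 - x) * Real.exp τ / (x * Real.exp τ - x + 1) ^ 2) τ := by
  have hn := (Real.hasDerivAt_exp τ).const_mul x
  refine (hn.div ((hn.sub_const x).add_const 1) h).congr_deriv ?_
  congr 1
  ring

lemma hasDerivAt_reversed_logistic {x : ℝ} (τ : ℝ) (h : x - x * Real.exp τ + Real.exp τ ≠ 0) :
    HasDerivAt (fun τ => x / (x - x * Real.exp τ + Real.exp τ))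
      (-(x * (1 - x) * Real.exp τ / (x - x * Real.exp τ + Real.exp τ) ^ 2)) τ := by
  have he := Real.hasDerivAt_exp τ
  refine ((hasDerivAt_const τ x).div (((he.const_mul x).const_sub x).add he) h).congr_deriv ?_
  rw [← neg_div]
  congr 1
  simp only [Pi.add_apply]
  ring

lemma tendsto_const_div_mul_exp_add_atTop {a : ℝ} (ha : 0 < a) (b c : ℝ) :
    Tendsto (fun τ => c / (a * Real.exp τ + b)) atTop (nhds 0) :=
  (tendsto_atTop_add_const_right _ b
    (Real.tendsto_exp_atTop.const_mul_atTop ha)).const_div_atTop c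

/-- Desynchronization of the reduced Friedmann dynamics at the dispersive Milne state:
for the flows `φ_τ(x) = x e^τ/(x e^τ − x + 1)` of `x' = x − x²` and
`ψ_τ(x) = x/(x − x e^τ + e^τ)` of `x' = x² − x`, and any state `x ∈ (0,1)`, the
difference `τ ↦ φ_τ(x) − ψ_τ(x)` is strictly increasing with strictly positive
derivative, and `|φ_τ(x) − ψ_τ(x)| → 1 ≠ 0` as `τ → ∞`; hence the synchronization
condition `lim |φ_τ(x) − ψ_τ(x)| = 0` fails. -/
theorem milne_reduced_dynamics_desynchronizes (x : ℝ) (hx : x ∈ Set.Ioo (0 : ℝ) 1)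
    (φ ψ : ℝ → ℝ)
    (hφ : φ = fun τ => x * Real.exp τ / (x * Real.exp τ - x + 1))
    (hψ : ψ = fun τ => x / (x - x * Real.exp τ + Real.exp τ)) :
    StrictMono (fun τ => φ τ - ψ τ) ∧
    (∀ τ : ℝ, 0 < deriv (fun τ => φ τ - ψ τ) τ) ∧
    Tendsto (fun τ => |φ τ - ψ τ|) atTop (nhds 1) ∧
    ¬ Tendsto (fun τ => |φ τ - ψ τ|) atTop (nhds 0) := by
  obtain ⟨hx0, hx1⟩ := hx
  have hy : 0 < 1 - x := sub_pos.2 hx1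
  have hA (τ : ℝ) : 0 < x * Real.exp τ - x + 1 := by
    linarith [mul_pos hx0 (Real.exp_pos τ)]
  have hB (τ : ℝ) : 0 < x - x * Real.exp τ + Real.exp τ := by
    linarith [mul_pos hy (Real.exp_pos τ)]
  have hderiv (τ : ℝ) : 0 < deriv (fun τ => φ τ - ψ τ) τ := by
    subst hφ hψ
    have h := (hasDerivAt_logistic τ (hA τ).ne').fun_sub
      (hasDerivAt_reversed_logistic τ (hB τ).ne')
    rw [h.deriv, sub_neg_eq_add]
    have hA' := hA τ
    have hB' := hB τ
    positivity
  have hlim : Tendsto (fun τ => |φ τ - ψ τ|) atTop (nhds 1) := by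
    have h := (((tendsto_const_div_mul_exp_add_atTop hx0 (1 - x) (1 - x)).const_sub 1).sub
      (tendsto_const_div_mul_exp_add_atTop hy x x)).abs
    simp only [sub_zero, abs_one] at h
    refine h.congr fun τ => ?_
    have h₁ : φ τ = 1 - (1 - x) / (x * Real.exp τ + (1 - x)) := by
      have hA' : x * Real.exp τ + (1 - x) ≠ 0 := by
        have := hA τ
        exact ne_of_gt (by linarith)
      rw [hφ, eq_sub_iff_add_eq]
      have e : x * Real.exp τ - x + 1 = x * Real.exp τ + (1 - x) := by ring
      simp only [e]
      rw [← add_div, div_self hA']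
    have h₂ : ψ τ = x / ((1 - x) * Real.exp τ + x) := by
      rw [hψ]
      ring
    rw [h₁, h₂]
  exact ⟨strictMono_of_deriv_pos hderiv, hderiv, hlim,
    fun h => one_ne_zero (tendsto_nhds_unique hlim h)⟩
end

section
/- For each x > 0, the function ψ(τ) = x / ((1+x)e^{τ} − x) is well defined for all τ ≥ 0, satisfies ψ(0) = x, solves dψ/dτ = −ψ − ψ² on [0,∞), and satisfies ψ(τ) → 0 as τ → ∞. Moreover, for x > 0 the difference φ_τ(x) − ψ_τ(x), where φ_τ(x) = x/((1+x)e^{−τ} − x) is the flow of x' = x + x², is strictly increasing in τ on the common domain of definition; hence the synchronization condition lim_{τ→∞}|φ_τ(x) − ψ_τ(x)| = 0 fails, and a Friedmann domain governed by the reduced dynamics at the dispersive flat state desynchronizes during its evolution. -/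
open Filter

/-- For `x > 0`, the curve `ψ(τ) = x/((1+x)e^τ − x)` is defined for all `τ ≥ 0`, starts
at `x`, solves `ψ' = −ψ − ψ²` on `[0,∞)` and tends to `0`; moreover the difference
`φ_τ(x) − ψ_τ(x)`, with `φ_τ(x) = x/((1+x)e^{−τ} − x)` the flow of `x' = x + x²`, is
strictly increasing on the common domain of definition `[0, ln((1+x)/x))`, and the
synchronization condition `lim_{τ→∞} |φ_τ(x) − ψ_τ(x)| = 0` fails: the dispersive flat
state desynchronizes. -/
theorem flat_state_desynchronizes (x : ℝ) (hx : 0 < x) (φ ψ : ℝ → ℝ)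
    (hφ : φ = fun τ => x / ((1 + x) * Real.exp (-τ) - x))
    (hψ : ψ = fun τ => x / ((1 + x) * Real.exp τ - x)) :
    (∀ τ : ℝ, 0 ≤ τ → 0 < (1 + x) * Real.exp τ - x) ∧
    ψ 0 = x ∧
    (∀ τ : ℝ, 0 ≤ τ → HasDerivAt ψ (-ψ τ - (ψ τ) ^ 2) τ) ∧
    Tendsto ψ atTop (nhds 0) ∧
    StrictMonoOn (fun τ => φ τ - ψ τ) (Set.Ico (0 : ℝ) (Real.log ((1 + x) / x))) ∧
    ¬ Tendsto (fun τ => |φ τ - ψ τ|) atTop (nhds 0) := by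
  have hx1 : 0 < 1 + x := by linarith
  have hpos : ∀ τ : ℝ, 0 ≤ τ → 0 < (1 + x) * Real.exp τ - x := by
    intro τ hτ
    nlinarith [Real.one_le_exp hτ]
  have hψ_lim : Tendsto ψ atTop (nhds 0) := by
    rw [hψ]
    refine Tendsto.const_div_atTop ?_ x
    exact tendsto_atTop_add_const_right _ (-x) (Real.tendsto_exp_atTop.const_mul_atTop hx1)
  have hφ_lim : Tendsto φ atTop (nhds (-1)) := by
    have hden : Tendsto (fun τ : ℝ => (1 + x) * Real.exp (-τ) - x) atTop
        (nhds ((1 + x) * 0 - x)) :=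
      (Real.tendsto_exp_neg_atTop_nhds_zero.const_mul (1 + x)).sub_const x
    have hne : (1 + x) * 0 - x ≠ 0 := by
      simpa using hx.ne'
    have hdiv := (tendsto_const_nhds (x := x)).div hden hne
    have hval : x / ((1 + x) * 0 - x) = -1 := by
      rw [div_eq_iff hne]
      ring
    rw [hφ, ← hval]
    exact hdiv
  refine ⟨hpos, ?_, ?_, hψ_lim, ?_, ?_⟩
  · simp [hψ]
  · intro τ hτ
    have hne := (hpos τ hτ).ne'
    have hden : HasDerivAt (fun τ => (1 + x) * Real.exp τ - x) ((1 + x) * Real.exp τ) τ :=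
      ((Real.hasDerivAt_exp τ).const_mul (1 + x)).sub_const x
    rw [hψ]
    refine ((hasDerivAt_const τ x).div hden hne).congr_deriv ?_
    field_simp
    ring
  · intro a ha b hb hab
    have hφ_den : 0 < (1 + x) * Real.exp (-b) - x := by
      have hlt := Real.exp_lt_exp.mpr hb.2
      rw [Real.exp_log (by positivity), lt_div_iff₀ hx] at hlt
      have hmul : Real.exp b * Real.exp (-b) = 1 := by
        rw [← Real.exp_add, add_neg_cancel, Real.exp_zero]
      nlinarith [Real.exp_pos (-b)]
    have hexp : Real.exp a < Real.exp b := Real.exp_lt_exp.mpr hab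
    have hexp_neg : Real.exp (-b) < Real.exp (-a) := Real.exp_lt_exp.mpr (neg_lt_neg hab)
    have hφ_lt : φ a < φ b := by
      rw [hφ]
      exact div_lt_div_of_pos_left hx hφ_den (by gcongr)
    have hψ_lt : ψ b < ψ a := by
      rw [hψ]
      exact div_lt_div_of_pos_left hx (hpos a ha.1) (by gcongr)
    exact sub_lt_sub hφ_lt hψ_lt
  · intro hsync
    have habs := tendsto_nhds_unique hsync (hφ_lim.sub hψ_lim).abs
    norm_num at habs
end
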